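/- arXiv:2104.12368 — 2 statements merged into one kernel-verified Lean document; each statement's English description precedes it below -/
import Mathlib

section
/- Let ξ be a centered Gaussian process with continuous covariance function K satisfying ∫_T K(x,x)² dν(x) ≤ κ⁴, and let C_K: L²(T,ν) → L²(T,ν) be the covariance operator (C_K f)(x) = ∫_T K(x,t) f(t) dν(t). Let W = (ω_1,…,ω_N) be sampled independently from (Ω,P), and let C_{K,W} := (1/N) Σ_{i=1}^N ξ(ω_i,·) ⊗ ξ(ω_i,·) be the sample covariance operator on L²(T,ν). Then for every 0 < δ < 1, with probability at least 1−δ, both ‖C_{K,W}‖_{HS(L²(T,ν))} ≤ 2κ²/δ and ‖C_{K,W} − C_K‖_{HS(L²(T,ν))} ≤ 2√3 κ²/(√N · δ). -/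
/- STATEMENT 11: `ξ` a centered Gaussian process (Cramér–Wold encoding) with continuous
covariance kernel `K`, `∫_T K(x,x)² dν ≤ κ⁴`, and sample paths a.s. in `L²(T,ν)`.
`C_K` is the covariance operator on `L²(T,ν)` and, for `W = (ω_1,…,ω_N)` i.i.d. from `P`,
`C_{K,W} = (1/N) Σ_i ξ(ω_i,·) ⊗ ξ(ω_i,·)` is the sample covariance operator (characterized,
for a.e. `W`, by `(C_{K,W} f)(x) = (1/N) Σ_i ξ(ω_i,x) ∫ ξ(ω_i,t) f(t) dν(t)`).
Then for every `0 < δ < 1`, with probability at least `1−δ`: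
`‖C_{K,W}‖_HS ≤ 2κ²/δ` and `‖C_{K,W} − C_K‖_HS ≤ 2√3 κ²/(√N δ)`.
The HS norm is computed along a Hilbert basis `e` of `L²(T,ν)`. -/

open MeasureTheory ProbabilityTheory
open scoped RealInnerProductSpace

noncomputable section

open scoped ENNReal NNReal

lemma integral_pow_four_gaussianReal (v : ℝ≥0) :
    ∫ x, x ^ 4 ∂(gaussianReal 0 v) = 3 * (v : ℝ) ^ 2 := by
  have h := iteratedDeriv_mgf_zero (X := fun x : ℝ => x) (μ := gaussianReal 0 v)
    (by simp) 4
  change _ = ∫ x, x ^ 4 ∂(gaussianReal 0 v) at h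
  rw [← h, mgf_fun_id_gaussianReal]
  have h0 (t : ℝ) : HasDerivAt (fun t : ℝ => Real.exp (0 * t + v * t ^ 2 / 2))
      (v * t * Real.exp (0 * t + v * t ^ 2 / 2)) t := by
    refine (((hasDerivAt_id t).const_mul (0 : ℝ)).add
      ((((hasDerivAt_id t).pow 2).const_mul (v : ℝ)).div_const 2)).exp.congr_deriv ?_
    simp
    ring
  have deriv_mul_exp (p : ℝ → ℝ) (p' : ℝ → ℝ) (hp : ∀ t, HasDerivAt p (p' t) t) :
      deriv (fun t => p t * Real.exp (0 * t + v * t ^ 2 / 2)) =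
        fun t => (p' t + v * t * p t) * Real.exp (0 * t + v * t ^ 2 / 2) := by
    ext t
    exact (((hp t).mul (h0 t)).congr_deriv (by ring)).deriv
  have deriv_exp_sq : deriv (fun t : ℝ => Real.exp (0 * t + v * t ^ 2 / 2)) =
      fun t => v * t * Real.exp (0 * t + v * t ^ 2 / 2) := by
    ext t; exact (h0 t).deriv
  have hlin (t : ℝ) : HasDerivAt (fun t : ℝ => (v : ℝ) * t) v t := by
    simpa using (hasDerivAt_id t).const_mul (v : ℝ)
  have hmono (c : ℝ) (n : ℕ) (t : ℝ) :
      HasDerivAt (fun t : ℝ => c * t ^ n) (c * (n * t ^ (n - 1))) t :=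
    (hasDerivAt_pow n t).const_mul c
  simp only [iteratedDeriv_succ, iteratedDeriv_zero]
  rw [deriv_exp_sq, deriv_mul_exp _ _ hlin,
    deriv_mul_exp _ (fun t => 2 * v ^ 2 * t) (fun t => by
      refine ((hmono (v ^ 2) 2 t).const_add (v : ℝ)).congr_deriv (by simp; ring)
        |>.congr_of_eventuallyEq (.of_forall fun t => by ring)),
    deriv_mul_exp _ (fun t => 3 * v ^ 2 + 3 * v ^ 3 * t ^ 2) (fun t => by
      refine ((hmono (3 * v ^ 2) 1 t).add (hmono (v ^ 3) 3 t)).congr_deriv (by simp; ring)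
        |>.congr_of_eventuallyEq (.of_forall fun t => by simp; ring))]
  simp

section SampleAverages

variable {Ω : Type*} [MeasurableSpace Ω] {P : Measure Ω}

lemma memLp_of_map_eq_gaussianReal {X : Ω → ℝ} {v : ℝ≥0} (hX : AEMeasurable X P)
    (hXv : P.map X = gaussianReal 0 v) {p : ℝ≥0∞} (hp : p ≠ ∞) : MemLp X p P := by
  have h := memLp_id_gaussianReal' (μ := 0) (v := v) p hp
  rw [← hXv, memLp_map_measure_iff aestronglyMeasurable_id hX] at h
  simpa using h

lemma integral_sq_of_map_eq_gaussianReal {X : Ω → ℝ} {v : ℝ≥0} (hX : AEMeasurable X P)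
    (hXv : P.map X = gaussianReal 0 v) : ∫ ω, X ω ^ 2 ∂P = v := by
  have h := variance_eq_sub (memLp_id_gaussianReal (μ := 0) (v := v) 2)
  rw [variance_id_gaussianReal] at h
  have h2 := integral_map (f := fun x : ℝ => x ^ 2) hX
    (by fun_prop)
  rw [← h2, hXv, h]
  simp

lemma integral_pow_four_of_map_eq_gaussianReal {X : Ω → ℝ} {v : ℝ≥0} (hX : AEMeasurable X P)
    (hXv : P.map X = gaussianReal 0 v) : ∫ ω, X ω ^ 4 ∂P = 3 * (v : ℝ) ^ 2 := by
  rw [← integral_pow_four_gaussianReal, ← hXv, integral_map hX (by fun_prop)]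

lemma memLp_mul_of_map_eq_gaussianReal {X Y : Ω → ℝ} {v w : ℝ≥0} (hX : AEMeasurable X P)
    (hXv : P.map X = gaussianReal 0 v) (hY : AEMeasurable Y P)
    (hYw : P.map Y = gaussianReal 0 w) : MemLp (fun ω => X ω * Y ω) 2 P := by
  have : ENNReal.HolderTriple 4 4 2 := ⟨by
    rw [show (4 : ℝ≥0∞) = 2 * 2 by norm_num, ENNReal.mul_inv (by simp) (by simp), ← mul_add,
      ENNReal.inv_two_add_inv_two, mul_one]⟩
  exact (memLp_of_map_eq_gaussianReal hY hYw (p := 4) (by simp)).mul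
    (memLp_of_map_eq_gaussianReal hX hXv (p := 4) (by simp))

lemma integral_mul_sq_le_of_map_eq_gaussianReal {X Y : Ω → ℝ} {v w : ℝ≥0}
    (hX : AEMeasurable X P) (hXv : P.map X = gaussianReal 0 v) (hY : AEMeasurable Y P)
    (hYw : P.map Y = gaussianReal 0 w) : ∫ ω, (X ω * Y ω) ^ 2 ∂P ≤ 3 * v * w := by
  have hX2 := memLp_mul_of_map_eq_gaussianReal hX hXv hX hXv
  have hY2 := memLp_mul_of_map_eq_gaussianReal hY hYw hY hYw
  have h := integral_mul_le_Lp_mul_Lq_of_nonneg (μ := P) Real.HolderConjugate.two_two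
    (f := fun ω => X ω * X ω) (g := fun ω => Y ω * Y ω)
    (.of_forall fun ω => mul_self_nonneg _) (.of_forall fun ω => mul_self_nonneg _)
    (by simpa using hX2) (by simpa using hY2)
  have eX (ω : Ω) : (X ω * X ω) ^ (2 : ℝ) = X ω ^ 4 := by rw [Real.rpow_two]; ring
  have eY (ω : Ω) : (Y ω * Y ω) ^ (2 : ℝ) = Y ω ^ 4 := by rw [Real.rpow_two]; ring
  simp only [eX, eY, ← Real.sqrt_eq_rpow, integral_pow_four_of_map_eq_gaussianReal hX hXv,
    integral_pow_four_of_map_eq_gaussianReal hY hYw] at h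
  calc ∫ ω, (X ω * Y ω) ^ 2 ∂P = ∫ ω, X ω * X ω * (Y ω * Y ω) ∂P := by
        congr 1; ext ω; ring
    _ ≤ _ := h
    _ = 3 * v * w := by
        rw [← Real.sqrt_mul (by positivity),
          show 3 * (v : ℝ) ^ 2 * (3 * w ^ 2) = (3 * v * w) ^ 2 by ring,
          Real.sqrt_sq (by positivity)]

lemma lintegral_pi_average_sub_sq_le [IsProbabilityMeasure P] {Z : Ω → ℝ} (hZ : MemLp Z 2 P)
    {N : ℕ} (hN : 0 < N) :
    ∫⁻ W, ‖(N : ℝ)⁻¹ * ∑ i, Z (W i) - ∫ ω, Z ω ∂P‖ₑ ^ 2 ∂(Measure.pi fun _ : Fin N => P) ≤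
      ENNReal.ofReal ((∫ ω, Z ω ^ 2 ∂P) / N) ∧
    ∫⁻ W, ‖(N : ℝ)⁻¹ * ∑ i, Z (W i)‖ₑ ^ 2 ∂(Measure.pi fun _ : Fin N => P) ≤
      ENNReal.ofReal (∫ ω, Z ω ^ 2 ∂P) := by
  set Q : Measure (Fin N → Ω) := Measure.pi fun _ : Fin N => P
  set S : (Fin N → Ω) → ℝ := fun W => (N : ℝ)⁻¹ * ∑ i, Z (W i)
  have hN' : (N : ℝ) ≠ 0 := by positivity
  have hN1 : (1 : ℝ) ≤ N := by exact_mod_cast hN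
  have hZi (i : Fin N) : MemLp (fun W : Fin N → Ω => Z (W i)) 2 Q :=
    hZ.comp_measurePreserving (measurePreserving_eval (fun _ => P) i)
  have hS : MemLp S 2 Q := (memLp_finsetSum _ fun i _ => hZi i).const_mul _
  have hmean : Q[S] = ∫ ω, Z ω ∂P := by
    simp only [S, integral_const_mul]
    rw [integral_finsetSum _ fun i _ => (hZi i).integrable (by simp)]
    have (i : Fin N) : ∫ W, Z (W i) ∂Q = ∫ ω, Z ω ∂P :=
      integral_comp_eval (μ := fun _ : Fin N => P) hZ.aestronglyMeasurable
    simp [this, hN']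
  have hvar : Var[S; Q] = Var[Z; P] / N := by
    have h := variance_sum_pi (μ := fun _ : Fin N => P) (X := fun _ => Z) (fun _ => hZ)
    have e : S = fun W => (N : ℝ)⁻¹ * (∑ i, fun W : Fin N → Ω => Z (W i)) W := by
      ext W; simp [S]
    rw [e, variance_const_mul, h]
    simp
    field_simp
  have hle : Var[Z; P] ≤ ∫ ω, Z ω ^ 2 ∂P :=
    variance_le_expectation_sq hZ.aestronglyMeasurable
  have hZvar := variance_eq_sub hZ
  have hSvar := variance_eq_sub hS
  have hlin {f : (Fin N → Ω) → ℝ} (hf : MemLp f 2 Q) :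
      ∫⁻ W, ‖f W‖ₑ ^ 2 ∂Q = ENNReal.ofReal (∫ W, f W ^ 2 ∂Q) := by
    rw [ofReal_integral_eq_lintegral_ofReal hf.integrable_sq (.of_forall fun _ => sq_nonneg _)]
    congr 1; ext W
    rw [← enorm_pow, Real.enorm_of_nonneg (sq_nonneg _)]
  constructor
  · have : ∫⁻ W, ‖S W - ∫ ω, Z ω ∂P‖ₑ ^ 2 ∂Q = evariance S Q := by
      rw [evariance, hmean]
    rw [this, ← ofReal_variance hS, hvar]
    gcongr
  · rw [hlin hS]
    refine ENNReal.ofReal_le_ofReal ?_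
    have h1 : Var[Z; P] / N ≤ Var[Z; P] := div_le_self (variance_nonneg _ _) hN1
    rw [hmean] at hSvar
    simp only [Pi.pow_apply] at hSvar hZvar
    linarith

lemma tsum_enorm_sq_le_lintegral_kernel {T : Type*} [MeasurableSpace T] (ν : Measure T)
    [SFinite ν] {k : T → T → ℝ} (hk : Measurable fun p : T × T => k p.1 p.2)
    {ι : Type*} [Countable ι] {e : ι → Lp ℝ 2 ν} (he : Orthonormal ℝ e) {a : ι → Lp ℝ 2 ν}
    (ha : ∀ i, a i =ᵐ[ν] fun x => ∫ t, k x t * e i t ∂ν) :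
    ∑' i, ‖a i‖ₑ ^ 2 ≤ ∫⁻ x, ∫⁻ t, ‖k x t‖ₑ ^ 2 ∂ν ∂ν := by
  have hsq (f : T → ℝ) : eLpNorm f 2 ν ^ 2 = ∫⁻ x, ‖f x‖ₑ ^ 2 ∂ν := by
    simpa using eLpNorm_nnreal_pow_eq_lintegral (f := f) (μ := ν) (p := 2) (by simp)
  have hmeas (i : ι) : Measurable fun x => ∫ t, k x t * e i t ∂ν := by
    have : StronglyMeasurable fun p : T × T => k p.1 p.2 * e i p.2 :=
      hk.stronglyMeasurable.mul ((Lp.stronglyMeasurable (e i)).comp_measurable measurable_snd)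
    exact this.integral_prod_right.measurable
  have hterm (i : ι) : ‖a i‖ₑ ^ 2 = ∫⁻ x, ‖∫ t, k x t * e i t ∂ν‖ₑ ^ 2 ∂ν := by
    rw [Lp.enorm_def, hsq]
    refine lintegral_congr_ae ?_
    filter_upwards [ha i] with x hx
    rw [hx]
  simp_rw [hterm]
  rw [← lintegral_tsum fun i => ((hmeas i).enorm.pow_const 2).aemeasurable]
  refine lintegral_mono fun x => ?_
  have hkx : Measurable (k x) := hk.comp measurable_prodMk_left
  by_cases hfin : ∫⁻ t, ‖k x t‖ₑ ^ 2 ∂ν = ∞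
  · simp [hfin]
  have hmem : MemLp (k x) 2 ν := by
    refine ⟨hkx.aestronglyMeasurable, lt_top_iff_ne_top.2 fun h => hfin ?_⟩
    rw [← hsq, h]; simp
  have hinner (i : ι) : ∫ t, k x t * e i t ∂ν = ⟪e i, hmem.toLp⟫ := by
    rw [L2.inner_def]
    refine integral_congr_ae ?_
    filter_upwards [hmem.coeFn_toLp] with t ht
    simp [ht]
  calc ∑' i, ‖∫ t, k x t * e i t ∂ν‖ₑ ^ 2
      = ∑' i, ENNReal.ofReal (‖⟪e i, hmem.toLp⟫‖ ^ 2) := by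
        congr 1; ext i
        rw [hinner, ENNReal.ofReal_pow (norm_nonneg _), ofReal_norm]
    _ = ENNReal.ofReal (∑' i, ‖⟪e i, hmem.toLp⟫‖ ^ 2) :=
        (ENNReal.ofReal_tsum_of_nonneg (fun _ => by positivity)
          (he.inner_products_summable _)).symm
    _ ≤ ENNReal.ofReal (‖hmem.toLp‖ ^ 2) :=
        ENNReal.ofReal_le_ofReal (he.tsum_inner_products_le _)
    _ = ∫⁻ t, ‖k x t‖ₑ ^ 2 ∂ν := by
        rw [ENNReal.ofReal_pow (norm_nonneg _), ofReal_norm, Lp.enorm_toLp, hsq]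

lemma sqrt_tsum_norm_sq_le {ι E : Type*} [NormedAddCommGroup E] {a : ι → E} {c : ℝ}
    (hc : 0 ≤ c) (h : ∑' i, ‖a i‖ₑ ^ 2 ≤ ENNReal.ofReal (c ^ 2)) :
    Real.sqrt (∑' i, ‖a i‖ ^ 2) ≤ c := by
  refine Real.sqrt_le_iff.2 ⟨hc, ?_⟩
  have := ENNReal.toReal_le_of_le_ofReal (sq_nonneg c) h
  rw [ENNReal.tsum_toReal_eq (fun _ => by finiteness)] at this
  simpa using this

lemma lintegral_lintegral_enorm_sq_le {T : Type*} [MeasurableSpace T] (ν : Measure T)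
    [SFinite ν] [SFinite P] {g : Ω → T → T → ℝ}
    (hg : Measurable fun p : Ω × T × T => g p.1 p.2.1 p.2.2) {d : T → ℝ} (hd : Measurable d)
    (hd0 : ∀ x, 0 ≤ d x) {c m : ℝ} (hc : 0 ≤ c) (hm : 0 ≤ m)
    (hdm : ∫⁻ x, ENNReal.ofReal (d x) ∂ν ≤ ENNReal.ofReal m)
    (hgd : ∀ x t, ∫⁻ ω, ‖g ω x t‖ₑ ^ 2 ∂P ≤ ENNReal.ofReal (c * (d x * d t))) :
    ∫⁻ ω, ∫⁻ x, ∫⁻ t, ‖g ω x t‖ₑ ^ 2 ∂ν ∂ν ∂P ≤ ENNReal.ofReal (c * m ^ 2) := by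
  have hmeas : Measurable fun p : (Ω × T) × T => ‖g p.1.1 p.1.2 p.2‖ₑ ^ 2 := by
    have : Measurable fun p : (Ω × T) × T => g p.1.1 p.1.2 p.2 :=
      hg.comp (by fun_prop : Measurable fun p : (Ω × T) × T => (p.1.1, p.1.2, p.2))
    exact this.enorm.pow_const 2
  rw [lintegral_lintegral_swap hmeas.lintegral_prod_right'.aemeasurable]
  calc ∫⁻ x, ∫⁻ ω, ∫⁻ t, ‖g ω x t‖ₑ ^ 2 ∂ν ∂P ∂ν
      = ∫⁻ x, ∫⁻ t, ∫⁻ ω, ‖g ω x t‖ₑ ^ 2 ∂P ∂ν ∂ν := by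
        refine lintegral_congr fun x => lintegral_lintegral_swap ?_
        exact (hmeas.comp (by fun_prop :
          Measurable fun p : Ω × T => ((p.1, x), p.2))).aemeasurable
    _ ≤ ∫⁻ x, ∫⁻ t, ENNReal.ofReal c * (ENNReal.ofReal (d x) * ENNReal.ofReal (d t)) ∂ν ∂ν := by
        refine lintegral_mono fun x => lintegral_mono fun t => (hgd x t).trans_eq ?_
        rw [ENNReal.ofReal_mul hc, ENNReal.ofReal_mul (hd0 x)]
    _ = ENNReal.ofReal c *
          ((∫⁻ x, ENNReal.ofReal (d x) ∂ν) * ∫⁻ t, ENNReal.ofReal (d t) ∂ν) := by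
        simp_rw [lintegral_const_mul' _ _ ENNReal.ofReal_ne_top]
        rw [lintegral_mul_const _ hd.ennreal_ofReal]
    _ ≤ ENNReal.ofReal c * (ENNReal.ofReal m * ENNReal.ofReal m) := by gcongr
    _ = ENNReal.ofReal (c * m ^ 2) := by
        rw [ENNReal.ofReal_mul hc, sq, ENNReal.ofReal_mul hm]

section PositiveDefiniteKernel

variable {T : Type*} {K : T → T → ℝ}

lemma kernel_self_nonneg (hKpos : ∀ (n : ℕ) (x : Fin n → T) (c : Fin n → ℝ),
      0 ≤ ∑ a, ∑ b, c a * c b * K (x a) (x b)) (x : T) : 0 ≤ K x x := by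
  simpa using hKpos 1 (fun _ => x) (fun _ => 1)

lemma kernel_sq_le (hKsymm : ∀ s t, K s t = K t s)
    (hKpos : ∀ (n : ℕ) (x : Fin n → T) (c : Fin n → ℝ),
      0 ≤ ∑ a, ∑ b, c a * c b * K (x a) (x b)) (x t : T) :
    K x t ^ 2 ≤ K x x * K t t := by
  have h := discrim_le_zero (a := K x x) (b := 2 * K x t) (c := K t t) fun r => by
    have := hKpos 2 ![x, t] ![r, 1]
    simp only [Fin.sum_univ_two, Matrix.cons_val_zero, Matrix.cons_val_one, hKsymm t x] at this
    linarith
  rw [discrim] at h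
  linarith

variable {ξ : Ω → T → ℝ}

lemma map_eval_eq_gaussianReal
    (hGauss : ∀ (n : ℕ) (x : Fin n → T) (a : Fin n → ℝ),
      Measure.map (fun ω => ∑ i, a i * ξ ω (x i)) P =
        gaussianReal 0 (∑ i, ∑ j, a i * a j * K (x i) (x j)).toNNReal) (x : T) :
    P.map (fun ω => ξ ω x) = gaussianReal 0 (K x x).toNNReal := by
  simpa using hGauss 1 (fun _ => x) (fun _ => 1)

lemma integral_eval_mul_eval (hKsymm : ∀ s t, K s t = K t s)
    (hKpos : ∀ (n : ℕ) (x : Fin n → T) (c : Fin n → ℝ),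
      0 ≤ ∑ a, ∑ b, c a * c b * K (x a) (x b))
    (hξ : ∀ x, Measurable fun ω => ξ ω x)
    (hGauss : ∀ (n : ℕ) (x : Fin n → T) (a : Fin n → ℝ),
      Measure.map (fun ω => ∑ i, a i * ξ ω (x i)) P =
        gaussianReal 0 (∑ i, ∑ j, a i * a j * K (x i) (x j)).toNNReal) (x t : T) :
    ∫ ω, ξ ω x * ξ ω t ∂P = K x t := by
  have hx := map_eval_eq_gaussianReal hGauss x
  have ht := map_eval_eq_gaussianReal hGauss t
  have hxt : P.map (fun ω => ξ ω x + ξ ω t) =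
      gaussianReal 0 (K x x + 2 * K x t + K t t).toNNReal := by
    have := hGauss 2 ![x, t] ![1, 1]
    simp only [Fin.sum_univ_two, Matrix.cons_val_zero, Matrix.cons_val_one, hKsymm t x,
      one_mul] at this
    rw [this]
    congr 2
    ring
  have h0 : 0 ≤ K x x + 2 * K x t + K t t := by
    have := hKpos 2 ![x, t] ![1, 1]
    simp only [Fin.sum_univ_two, Matrix.cons_val_zero, Matrix.cons_val_one, hKsymm t x] at this
    linarith
  have ix := integral_sq_of_map_eq_gaussianReal (hξ x).aemeasurable hx
  have it := integral_sq_of_map_eq_gaussianReal (hξ t).aemeasurable ht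
  have ixt := integral_sq_of_map_eq_gaussianReal (X := fun ω => ξ ω x + ξ ω t)
    ((hξ x).add (hξ t)).aemeasurable hxt
  rw [Real.coe_toNNReal _ (kernel_self_nonneg hKpos _)] at ix it
  rw [Real.coe_toNNReal _ h0] at ixt
  have mx := memLp_of_map_eq_gaussianReal (hξ x).aemeasurable hx (p := 2) (by simp)
  have mt := memLp_of_map_eq_gaussianReal (hξ t).aemeasurable ht (p := 2) (by simp)
  have hmul : Integrable (fun ω => ξ ω x * ξ ω t) P := mx.integrable_mul mt
  have e (ω : Ω) : (ξ ω x + ξ ω t) ^ 2 = ξ ω x ^ 2 + 2 * (ξ ω x * ξ ω t) + ξ ω t ^ 2 := by ring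
  simp only [e] at ixt
  have hadd : Integrable (fun ω => ξ ω x ^ 2 + 2 * (ξ ω x * ξ ω t)) P :=
    mx.integrable_sq.add (hmul.const_mul 2)
  rw [integral_add hadd mt.integrable_sq,
    integral_add mx.integrable_sq (hmul.const_mul 2), integral_const_mul] at ixt
  linarith

end PositiveDefiniteKernel

end SampleAverages

theorem sample_covariance_operator_concentration
    {T : Type*} [MetricSpace T] [SigmaCompactSpace T] [MeasurableSpace T] [BorelSpace T]
    (ν : Measure T) [IsProbabilityMeasure ν]
    (K : T → T → ℝ)
    (hKcont : Continuous fun p : T × T => K p.1 p.2)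
    (hKsymm : ∀ s t, K s t = K t s)
    (hKpos : ∀ (n : ℕ) (x : Fin n → T) (c : Fin n → ℝ),
      0 ≤ ∑ a, ∑ b, c a * c b * K (x a) (x b))
    (κ : ℝ) (hκ : 0 < κ)
    (hKint : Integrable (fun x => K x x ^ 2) ν)
    (hbound : ∫ x, K x x ^ 2 ∂ν ≤ κ ^ 4)
    {Ω : Type*} [MeasurableSpace Ω] (P : Measure Ω) [IsProbabilityMeasure P]
    (ξ : Ω → T → ℝ)
    (hjm : Measurable fun p : Ω × T => ξ p.1 p.2)
    (hGauss : ∀ (n : ℕ) (x : Fin n → T) (a : Fin n → ℝ),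
      Measure.map (fun ω => ∑ i, a i * ξ ω (x i)) P =
        gaussianReal 0 (∑ i, ∑ j, a i * a j * K (x i) (x j)).toNNReal)
    (hpaths : ∀ᵐ ω ∂P, Integrable (fun t => ξ ω t ^ 2) ν)
    (C : Lp ℝ 2 ν →L[ℝ] Lp ℝ 2 ν)
    (hC : ∀ f : Lp ℝ 2 ν, ⇑(C f) =ᵐ[ν] fun x => ∫ t, K x t * f t ∂ν)
    (N : ℕ) (hN : 0 < N)
    (CW : (Fin N → Ω) → Lp ℝ 2 ν →L[ℝ] Lp ℝ 2 ν)
    (hCW : ∀ᵐ W ∂(Measure.pi fun _ : Fin N => P), ∀ f : Lp ℝ 2 ν,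
      ⇑(CW W f) =ᵐ[ν] fun x =>
        (N : ℝ)⁻¹ * ∑ i, ξ (W i) x * ∫ t, ξ (W i) t * f t ∂ν)
    {ι : Type*} [Countable ι] (e : HilbertBasis ι ℝ (Lp ℝ 2 ν))
    (δ : ℝ) (hδ0 : 0 < δ) (hδ1 : δ < 1) :
    ENNReal.ofReal (1 - δ) ≤
      (Measure.pi fun _ : Fin N => P) {W : Fin N → Ω |
        Real.sqrt (∑' k, ‖CW W (e k)‖ ^ 2) ≤ 2 * κ ^ 2 / δ ∧
        Real.sqrt (∑' k, ‖(CW W - C) (e k)‖ ^ 2) ≤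
          2 * Real.sqrt 3 * κ ^ 2 / (Real.sqrt N * δ) } := by
  set Q : Measure (Fin N → Ω) := Measure.pi fun _ : Fin N => P
  have hξ (x : T) : Measurable fun ω => ξ ω x := hjm.comp measurable_prodMk_right
  have hKmeas : Measurable fun p : T × T => K p.1 p.2 := hKcont.measurable
  have hd : Measurable fun x => K x x :=
    hKmeas.comp (measurable_id.prodMk measurable_id)
  have hd0 := kernel_self_nonneg hKpos
  have hNpos : (0 : ℝ) < N := by exact_mod_cast hN
  have hdint : Integrable (fun x => K x x) ν :=
    ((memLp_two_iff_integrable_sq hd.aestronglyMeasurable).2 hKint).integrable (by simp)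
  have htrace : ∫⁻ x, ENNReal.ofReal (K x x) ∂ν ≤ ENNReal.ofReal (κ ^ 2) := by
    rw [← ofReal_integral_eq_lintegral_ofReal hdint (.of_forall hd0)]
    refine ENNReal.ofReal_le_ofReal ?_
    refine abs_le_of_sq_le_sq' (a := ∫ x, K x x ∂ν) ?_ (sq_nonneg κ) |>.2
    have h1 := variance_nonneg (fun x => K x x) ν
    rw [variance_eq_sub ((memLp_two_iff_integrable_sq hd.aestronglyMeasurable).2 hKint)] at h1
    simp only [Pi.pow_apply] at h1
    nlinarith
  have hprod (x t : T) := memLp_mul_of_map_eq_gaussianReal (hξ x).aemeasurable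
    (map_eval_eq_gaussianReal hGauss x) (hξ t).aemeasurable (map_eval_eq_gaussianReal hGauss t)
  have hfour (x t : T) : ∫ ω, (ξ ω x * ξ ω t) ^ 2 ∂P ≤ 3 * (K x x * K t t) := by
    have h := integral_mul_sq_le_of_map_eq_gaussianReal (hξ x).aemeasurable
      (map_eval_eq_gaussianReal hGauss x) (hξ t).aemeasurable (map_eval_eq_gaussianReal hGauss t)
    rwa [Real.coe_toNNReal _ (hd0 x), Real.coe_toNNReal _ (hd0 t), mul_assoc] at h
  let k : (Fin N → Ω) → T → T → ℝ := fun W x t => (N : ℝ)⁻¹ * ∑ i, ξ (W i) x * ξ (W i) t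
  have hk : Measurable fun p : (Fin N → Ω) × T × T => k p.1 p.2.1 p.2.2 := by
    refine (Finset.measurable_fun_sum _ fun i _ => ?_).const_mul _
    exact (hjm.comp (by fun_prop :
        Measurable fun p : (Fin N → Ω) × T × T => (p.1 i, p.2.1))).mul
      (hjm.comp (by fun_prop : Measurable fun p : (Fin N → Ω) × T × T => (p.1 i, p.2.2)))
  have hkK : Measurable fun p : (Fin N → Ω) × T × T => k p.1 p.2.1 p.2.2 - K p.2.1 p.2.2 :=
    hk.sub (hKmeas.comp measurable_snd)
  have hF := lintegral_lintegral_enorm_sq_le (P := Q) ν hk hd hd0 (c := 3) (by norm_num)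
    (sq_nonneg κ) htrace fun x t =>
      (lintegral_pi_average_sub_sq_le (hprod x t) hN).2.trans
        (ENNReal.ofReal_le_ofReal (hfour x t))
  have hG := lintegral_lintegral_enorm_sq_le (P := Q) ν hkK hd hd0 (c := 3 / N) (by positivity)
    (sq_nonneg κ) htrace fun x t => by
      have h := (lintegral_pi_average_sub_sq_le (hprod x t) hN).1
      rw [integral_eval_mul_eval hKsymm hKpos hξ hGauss x t] at h
      refine h.trans (ENNReal.ofReal_le_ofReal ?_)
      rw [div_mul_eq_mul_div]
      gcongr
      exact hfour x t
  set F : (Fin N → Ω) → ℝ≥0∞ := fun W => ∫⁻ x, ∫⁻ t, ‖k W x t‖ₑ ^ 2 ∂ν ∂ν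
  set G : (Fin N → Ω) → ℝ≥0∞ := fun W => ∫⁻ x, ∫⁻ t, ‖k W x t - K x t‖ₑ ^ 2 ∂ν ∂ν
  have hmeas {g : (Fin N → Ω) → T → T → ℝ}
      (hg : Measurable fun p : (Fin N → Ω) × T × T => g p.1 p.2.1 p.2.2) :
      Measurable fun W => ∫⁻ x, ∫⁻ t, ‖g W x t‖ₑ ^ 2 ∂ν ∂ν := by
    have h : Measurable fun p : ((Fin N → Ω) × T) × T => g p.1.1 p.1.2 p.2 :=
      hg.comp (by fun_prop :
        Measurable fun p : ((Fin N → Ω) × T) × T => (p.1.1, p.1.2, p.2))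
    exact (h.enorm.pow_const 2).lintegral_prod_right'.lintegral_prod_right'
  set c₁ : ℝ := 2 * κ ^ 2 / δ
  set c₂ : ℝ := 2 * Real.sqrt 3 * κ ^ 2 / (Real.sqrt N * δ)
  have hc₁ : 0 < c₁ := by positivity
  have hc₂ : 0 < c₂ := by positivity
  have markov {H : (Fin N → Ω) → ℝ≥0∞} (hH : Measurable H) {b c q : ℝ} (hc : 0 < c)
      (hHb : ∫⁻ W, H W ∂Q ≤ ENNReal.ofReal b) (hq : b / c ^ 2 = q) :
      Q {W | ENNReal.ofReal (c ^ 2) ≤ H W} ≤ ENNReal.ofReal q := by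
    have hc2 : 0 < c ^ 2 := by positivity
    refine (meas_ge_le_lintegral_div hH.aemeasurable (by simpa using hc2.ne')
      ENNReal.ofReal_ne_top).trans ?_
    rw [← hq, ENNReal.ofReal_div_of_pos hc2]
    gcongr
  have hA := markov (hmeas hk) (q := 3 / 4 * δ ^ 2) hc₁ hF (by
    simp only [c₁]; field_simp; norm_num)
  have hB := markov (hmeas hkK) (q := 1 / 4 * δ ^ 2) hc₂ hG (by
    simp only [c₂, div_pow, mul_pow]
    rw [Real.sq_sqrt hNpos.le, Real.sq_sqrt (by norm_num)]
    field_simp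
    norm_num)
  have hKLp (x : T) : MemLp (K x) 2 ν := by
    have hKx : Measurable (K x) := hKmeas.comp measurable_prodMk_left
    refine (memLp_two_iff_integrable_sq hKx.aestronglyMeasurable).2 ?_
    refine (hdint.const_mul (K x x)).mono' (hKx.pow_const 2).aestronglyMeasurable ?_
    refine .of_forall fun t => ?_
    rw [Real.norm_of_nonneg (sq_nonneg _)]
    exact kernel_sq_le hKsymm hKpos x t
  have hpathsW : ∀ᵐ W ∂Q, ∀ i, MemLp (ξ (W i)) 2 ν := by
    refine ae_all_iff.2 fun i => ?_
    filter_upwards [(measurePreserving_eval (fun _ : Fin N => P) i).quasiMeasurePreserving.ae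
      hpaths] with W hW
    exact (memLp_two_iff_integrable_sq
      (hjm.comp measurable_prodMk_left).aestronglyMeasurable).2 hW
  have hgood : ∀ᵐ W ∂Q, Real.sqrt (∑' j, ‖CW W (e j)‖ ^ 2) > c₁ ∨
      Real.sqrt (∑' j, ‖(CW W - C) (e j)‖ ^ 2) > c₂ →
      ENNReal.ofReal (c₁ ^ 2) ≤ F W ∨ ENNReal.ofReal (c₂ ^ 2) ≤ G W := by
    filter_upwards [hpathsW, hCW] with W hWp hW
    have hint (f : Lp ℝ 2 ν) (i : Fin N) (x : T) :
        Integrable (fun t => ξ (W i) x * (ξ (W i) t * f t)) ν :=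
      ((hWp i).integrable_mul (Lp.memLp f)).const_mul _
    have hksum (f : Lp ℝ 2 ν) (x t : T) :
        k W x t * f t = (N : ℝ)⁻¹ * ∑ i, ξ (W i) x * (ξ (W i) t * f t) := by
      simp only [k, mul_assoc, Finset.sum_mul]
    have hkint (f : Lp ℝ 2 ν) (x : T) : Integrable (fun t => k W x t * f t) ν := by
      simp only [hksum]
      exact (integrable_finsetSum _ fun i _ => hint f i x).const_mul _
    have hCWk (f : Lp ℝ 2 ν) : CW W f =ᵐ[ν] fun x => ∫ t, k W x t * f t ∂ν := by
      filter_upwards [hW f] with x hx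
      simp only [hx, hksum]
      rw [integral_const_mul, integral_finsetSum _ fun i _ => hint f i x]
      simp only [integral_const_mul]
    have hdiff (f : Lp ℝ 2 ν) :
        (CW W - C) f =ᵐ[ν] fun x => ∫ t, (k W x t - K x t) * f t ∂ν := by
      rw [sub_apply]
      filter_upwards [Lp.coeFn_sub (CW W f) (C f), hCWk f, hC f] with x h1 h2 h3
      have hKf : Integrable (fun t => K x t * f t) ν := (hKLp x).integrable_mul (Lp.memLp f)
      rw [h1, Pi.sub_apply, h2, h3, ← integral_sub (hkint f x) hKf]
      simp only [sub_mul]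
    have hFW := tsum_enorm_sq_le_lintegral_kernel ν
      (hk.comp measurable_prodMk_left : Measurable fun p : T × T => k W p.1 p.2)
      e.orthonormal fun j => hCWk (e j)
    have hGW := tsum_enorm_sq_le_lintegral_kernel ν
      (hkK.comp measurable_prodMk_left : Measurable fun p : T × T => k W p.1 p.2 - K p.1 p.2)
      e.orthonormal fun j => hdiff (e j)
    contrapose!
    rintro ⟨h1, h2⟩
    exact ⟨sqrt_tsum_norm_sq_le hc₁.le (hFW.trans h1.le),
      sqrt_tsum_norm_sq_le hc₂.le (hGW.trans h2.le)⟩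
  set S : Set (Fin N → Ω) := {W | Real.sqrt (∑' j, ‖CW W (e j)‖ ^ 2) ≤ c₁ ∧
    Real.sqrt (∑' j, ‖(CW W - C) (e j)‖ ^ 2) ≤ c₂}
  have hSc : Q Sᶜ ≤ ENNReal.ofReal δ := by
    calc Q Sᶜ ≤ Q ({W | ENNReal.ofReal (c₁ ^ 2) ≤ F W} ∪ {W | ENNReal.ofReal (c₂ ^ 2) ≤ G W}) := by
          refine measure_mono_ae ?_
          filter_upwards [hgood] with W hW hWS
          refine hW ?_
          by_contra! h
          exact hWS h
      _ ≤ ENNReal.ofReal (3 / 4 * δ ^ 2) + ENNReal.ofReal (1 / 4 * δ ^ 2) :=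
          (measure_union_le _ _).trans (add_le_add hA hB)
      _ = ENNReal.ofReal (δ ^ 2) := by
          rw [← ENNReal.ofReal_add (by positivity) (by positivity)]
          congr 1; ring
      _ ≤ ENNReal.ofReal δ := ENNReal.ofReal_le_ofReal (by nlinarith)
  have hone : 1 ≤ Q S + Q Sᶜ := by
    rw [← measure_univ (μ := Q), ← Set.union_compl_self S]
    exact measure_union_le _ _
  rw [ENNReal.ofReal_sub _ hδ0.le, ENNReal.ofReal_one]
  exact tsub_le_iff_right.2 (hone.trans (by gcongr))

end
end

section
/- Let H be a real separable Hilbert space and A, B self-adjoint positive trace-class operators on H. Then for every r with 0 ≤ r ≤ 1, the operator (I+A)^r − (I+B)^r is trace class and ‖(I+A)^r − (I+B)^r‖_tr ≤ r ‖A − B‖_tr. -/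
/- STATEMENT 15: For self-adjoint positive trace-class operators `A, B` on a real separable
Hilbert space `H` and `0 ≤ r ≤ 1`, the operator `(I+A)^r − (I+B)^r` is trace class and
`‖(I+A)^r − (I+B)^r‖_tr ≤ r ‖A − B‖_tr`.

Encoding: since `A` (resp. `B`) is a positive trace-class (hence compact self-adjoint)
operator, it is diagonalized by a Hilbert basis `e` (resp. `f`) with nonnegative summable
eigenvalue sequence `lam` (resp. `mu`); these diagonalizations are supplied as hypotheses,
and they determine the operator powers by the continuous functional calculus:
`(I+A)^r` is the (unique) continuous linear operator `Ar` with `Ar (e k) = (1+lam k)^r • e k`,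
and similarly for `Br`. The trace norm of a self-adjoint operator `C` is
`∑' k, ⟪g k, S (g k)⟫` for a Hilbert basis `g`, where `S` is the (unique) positive square
root of `C* ∘ C`, i.e. `S = |C|`; trace-class-ness of `C` is summability of that family. -/

open scoped RealInnerProductSpace

noncomputable section

section Eigenbasis

universe u

variable {H : Type u} [NormedAddCommGroup H] [InnerProductSpace ℝ H] {ι κ : Type*}

theorem HilbertBasis.hasSum_inner_apply_of_eigen (e : HilbertBasis ι ℝ H) {T : H →L[ℝ] H}
    {lam : ι → ℝ} (hT : ∀ k, T (e k) = lam k • e k) (x y : H) :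
    HasSum (fun k => lam k * (⟪x, e k⟫ * ⟪e k, y⟫)) ⟪x, T y⟫ := by
  convert! ((e.hasSum_repr y).mapL T).mapL (innerSL ℝ x) using 1
  ext k
  simp only [map_smul, hT, innerSL_apply_apply, e.repr_apply_apply, smul_eq_mul]
  ring

theorem HilbertBasis.isSymmetric_of_eigen (e : HilbertBasis ι ℝ H) {T : H →L[ℝ] H}
    {lam : ι → ℝ} (hT : ∀ k, T (e k) = lam k • e k) : (T : H →ₗ[ℝ] H).IsSymmetric := by
  intro x y
  change ⟪T x, y⟫ = ⟪x, T y⟫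
  rw [real_inner_comm]
  refine (e.hasSum_inner_apply_of_eigen hT y x).unique ?_
  convert! e.hasSum_inner_apply_of_eigen hT x y using 3 with k
  rw [real_inner_comm (e k) y, real_inner_comm x]
  ring

theorem HilbertBasis.isCompactOperator_of_eigen_of_summable [CompleteSpace H]
    (e : HilbertBasis ι ℝ H) {T : H →L[ℝ] H} {lam : ι → ℝ}
    (hT : ∀ k, T (e k) = lam k • e k) (hlam : Summable fun k => |lam k|) :
    IsCompactOperator T := by
  set P : ι → H →L[ℝ] H := fun k => (innerSL ℝ (e k)).smulRight (lam k • e k) with hP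
  have hPn : ∀ k, ‖P k‖ = |lam k| := fun k => by
    simp [hP, norm_smul, e.orthonormal.1 k]
  have hsum : Summable P := Summable.of_norm (by simpa only [hPn] using hlam)
  have hTP : T = ∑' k, P k := by
    ext x
    refine ((e.hasSum_repr x).mapL T).unique ?_
    convert! hsum.hasSum.mapL (ContinuousLinearMap.apply ℝ H x) using 1
    ext k
    simp [hP, hT, e.repr_apply_apply, smul_smul]
  rw [hTP]
  refine isCompactOperator_of_tendsto (l := Filter.atTop) hsum.hasSum (.of_forall fun s => ?_)
  have : ∀ k, P k ∈ compactOperator (RingHom.id ℝ) H H := fun k => by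
    have h : IsCompactOperator (innerSL ℝ (e k) : H →L[ℝ] ℝ) :=
      isCompactOperator_of_locallyCompactSpace_dom (innerSL ℝ (e k) : H →L[ℝ] ℝ)
    exact h.clm_comp (ContinuousLinearMap.toSpanSingleton ℝ (lam k • e k))
  exact Submodule.sum_mem _ fun k _ => this k

theorem IsCompactOperator.exists_hilbertBasis_eigen [CompleteSpace H] {T : H →L[ℝ] H}
    (hT : IsCompactOperator T) (hT' : (T : H →ₗ[ℝ] H).IsSymmetric) :
    ∃ (w : Type u) (h : HilbertBasis w ℝ H) (c : w → ℝ), ∀ k, T (h k) = c k • h k := by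
  let E : ℝ → Submodule ℝ H := fun μ => Module.End.eigenspace (T : H →ₗ[ℝ] H) μ
  have hE : ∀ μ x, x ∈ E μ ↔ T x = μ • x := fun μ x => Module.End.mem_eigenspace_iff
  have hcl : ∀ μ, CompleteSpace (E μ) := fun μ => by
    refine IsClosed.completeSpace_coe (hs := ?_)
    have : (E μ : Set H) = {x | T x = μ • x} := Set.ext fun x => hE μ x
    rw [this]
    exact isClosed_eq T.continuous (continuous_const_smul μ)
  choose w b hb using fun μ => exists_hilbertBasis ℝ (E μ)
  have ho : Orthonormal ℝ fun a : Σ μ, w μ => ((b a.1 a.2 : E a.1) : H) :=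
    hT'.orthogonalFamily_eigenspaces.orthonormal_sigma_orthonormal
      fun μ => (b μ).orthonormal
  refine ⟨_, HilbertBasis.mkOfOrthogonalEqBot ho ?_, fun a : Σ μ, w μ => a.1, fun k => ?_⟩
  · rw [← ContinuousLinearMap.orthogonalComplement_iSup_eigenspaces_eq_bot hT hT']
    refine le_antisymm ?_ ?_
    · intro x hx
      rw [Submodule.mem_orthogonal] at hx
      rw [← Submodule.iInf_orthogonal, Submodule.mem_iInf]
      intro μ
      rw [Submodule.mem_orthogonal]
      intro y hy
      refine ((((b μ).hasSum_repr ⟨y, hy⟩).mapL (E μ).subtypeL).mapL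
        (innerSL ℝ x)).unique ?_ |> fun h => (real_inner_comm _ _).trans h
      convert! hasSum_zero using 1
      ext i
      have := hx _ (Submodule.subset_span ⟨⟨μ, i⟩, rfl⟩)
      simp only [map_smul, innerSL_apply_apply, smul_eq_mul]
      rw [real_inner_comm]
      exact mul_eq_zero_of_right _ this
    · refine Submodule.orthogonal_le (Submodule.span_le.2 ?_)
      rintro _ ⟨a, rfl⟩
      exact Submodule.mem_iSup_of_mem a.1 (b a.1 a.2).2
  · rw [HilbertBasis.coe_mkOfOrthogonalEqBot]
    exact (hE _ _).1 (b k.1 k.2).2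

theorem HilbertBasis.tsum_ofReal_inner_sq (e : HilbertBasis ι ℝ H) (x : H) :
    ∑' k, ENNReal.ofReal (⟪x, e k⟫ ^ 2) = ENNReal.ofReal (‖x‖ ^ 2) := by
  have h := e.hasSum_inner_mul_inner x x
  simp only [real_inner_comm x, ← sq, real_inner_self_eq_norm_sq] at h
  rw [← h.tsum_eq, ENNReal.ofReal_tsum_of_nonneg (fun _ => sq_nonneg _) h.summable]

/-- The trace of a positive operator does not depend on the Hilbert basis. -/
theorem HilbertBasis.tsum_ofReal_inner_apply_eq (g : HilbertBasis ι ℝ H) (h : HilbertBasis κ ℝ H)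
    {S : H →L[ℝ] H} {s : κ → ℝ} (hs : ∀ k, 0 ≤ s k) (hS : ∀ k, S (h k) = s k • h k) :
    ∑' i, ENNReal.ofReal ⟪g i, S (g i)⟫ = ∑' k, ENNReal.ofReal (s k) := by
  have h1 : ∀ i, ENNReal.ofReal ⟪g i, S (g i)⟫ =
      ∑' k, ENNReal.ofReal (s k) * ENNReal.ofReal (⟪h k, g i⟫ ^ 2) := fun i => by
    have := h.hasSum_inner_apply_of_eigen hS (g i) (g i)
    simp only [real_inner_comm (g i), ← sq] at this
    rw [← this.tsum_eq, ENNReal.ofReal_tsum_of_nonneg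
      (fun k => mul_nonneg (hs k) (sq_nonneg _)) this.summable]
    simp only [ENNReal.ofReal_mul (hs _), real_inner_comm]
  simp only [h1]
  rw [ENNReal.tsum_comm]
  refine tsum_congr fun k => ?_
  rw [ENNReal.tsum_mul_left, g.tsum_ofReal_inner_sq, h.orthonormal.1 k]
  simp

theorem HilbertBasis.tsum_ofReal_abs_inner_apply_le (h : HilbertBasis ι ℝ H)
    (d : HilbertBasis κ ℝ H) {D X Y : H →L[ℝ] H} {δ : κ → ℝ} (hD : ∀ m, D (d m) = δ m • d m)
    (hX : (X : H →ₗ[ℝ] H).IsSymmetric) (hY : (Y : H →ₗ[ℝ] H).IsSymmetric) {M : ℝ}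
    (hXM : ‖X‖ ≤ M) (hYM : ‖Y‖ ≤ M) :
    ∑' k, ENNReal.ofReal |⟪X (h k), D (Y (h k))⟫| ≤
      ENNReal.ofReal (M ^ 2) * ∑' m, ENNReal.ofReal |δ m| := by
  have hM : 0 ≤ M := (norm_nonneg _).trans hXM
  have h1 : ∀ k, ENNReal.ofReal |⟪X (h k), D (Y (h k))⟫| ≤
      ∑' m, ENNReal.ofReal |δ m| * (ENNReal.ofReal (⟪X (d m), h k⟫ ^ 2 / 2) +
        ENNReal.ofReal (⟪Y (d m), h k⟫ ^ 2 / 2)) := fun k => by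
    have := d.hasSum_inner_apply_of_eigen hD (X (h k)) (Y (h k))
    rw [← this.tsum_eq, ← Real.enorm_eq_ofReal_abs]
    refine (enorm_tsum_le_tsum_enorm).trans (ENNReal.tsum_le_tsum fun m => ?_)
    rw [Real.enorm_eq_ofReal_abs, abs_mul, ENNReal.ofReal_mul (abs_nonneg _)]
    gcongr
    rw [← ENNReal.ofReal_add (by positivity) (by positivity)]
    refine ENNReal.ofReal_le_ofReal ?_
    have e1 : ⟪X (h k), d m⟫ = ⟪X (d m), h k⟫ := by rw [hX.apply_clm, real_inner_comm]
    have e2 : ⟪d m, Y (h k)⟫ = ⟪Y (d m), h k⟫ := by rw [hY.apply_clm]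
    rw [e1, e2, abs_le]
    constructor <;> nlinarith [sq_nonneg (⟪X (d m), h k⟫ + ⟪Y (d m), h k⟫),
      sq_nonneg (⟪X (d m), h k⟫ - ⟪Y (d m), h k⟫)]
  refine (ENNReal.tsum_le_tsum h1).trans ?_
  rw [ENNReal.tsum_comm, ← ENNReal.tsum_mul_left]
  refine ENNReal.tsum_le_tsum fun m => ?_
  rw [ENNReal.tsum_mul_left, mul_comm]
  gcongr
  have h2 : ∀ Z : H →L[ℝ] H, ‖Z‖ ≤ M →
      ∑' k, ENNReal.ofReal (⟪Z (d m), h k⟫ ^ 2 / 2) ≤ ENNReal.ofReal (M ^ 2 / 2) := fun Z hZ => by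
    simp only [div_eq_mul_inv, ENNReal.ofReal_mul (sq_nonneg _)]
    rw [ENNReal.tsum_mul_right, h.tsum_ofReal_inner_sq]
    gcongr
    exact (Z.le_opNorm _).trans (by simpa [d.orthonormal.1 m] using hZ)
  rw [ENNReal.tsum_add]
  refine (add_le_add (h2 X hXM) (h2 Y hYM)).trans ?_
  rw [← ENNReal.ofReal_add (by positivity) (by positivity), add_halves]

theorem ContinuousLinearMap.IsPositive.apply_eigen_of_sq [CompleteSpace H] {S T : H →L[ℝ] H}
    (hS : S.IsPositive) (hT : (T : H →ₗ[ℝ] H).IsSymmetric)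
    (hST : S ∘L S = T.adjoint ∘L T) {c : ℝ} {v : H} (hv : T v = c • v) : S v = |c| • v := by
  have hT' : T.adjoint = T := hT.isSelfAdjoint.adjoint_eq
  have hSS : S (S v) = (c ^ 2) • v := by
    have := congr($hST v)
    simpa [hT', hv, smul_smul, sq] using this
  have hu : S (S v - |c| • v) = -|c| • (S v - |c| • v) := by
    rw [map_sub, map_smul, hSS, ← sq_abs]
    module
  have h0 := hS.inner_nonneg_right (S v - |c| • v)
  rw [hu, inner_smul_right, real_inner_self_eq_norm_sq] at h0
  rcases (abs_nonneg c).eq_or_lt with hc | hc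
  · rw [← hc, zero_smul]
    have : ⟪S v, S v⟫ = 0 := by
      rw [hS.inner_left_eq_inner_right, hSS, ← sq_abs, ← hc]; simp
    exact inner_self_eq_zero.1 this
  · have : ‖S v - |c| • v‖ ^ 2 = 0 := by nlinarith [sq_nonneg ‖S v - |c| • v‖]
    exact sub_eq_zero.1 (norm_eq_zero.1 (pow_eq_zero_iff two_ne_zero |>.1 this))

end Eigenbasis

section Resolvent

variable {H : Type*} [NormedAddCommGroup H] [InnerProductSpace ℝ H]

/-- The resolvent `(T + s)⁻¹`, equal to zero when `T + s` is not invertible. -/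
def positiveResolvent (T : H →L[ℝ] H) (s : ℝ) : H →L[ℝ] H := Ring.inverse (T + s • 1)

namespace ContinuousLinearMap.IsPositive

variable [CompleteSpace H] {T : H →L[ℝ] H} (hT : T.IsPositive) {s : ℝ} (hs : 0 < s)

include hT hs

theorem isUnit_add_smul_one : IsUnit (T + s • 1) := by
  refine isUnit_of_forall_le_norm_inner_map _ (c := ⟨s, hs.le⟩) hs fun x => ?_
  refine le_trans ?_ (le_abs_self _)
  have := hT.inner_nonneg_left x
  simp only [add_apply, smul_apply, one_apply_eq_self, inner_add_left, inner_smul_left,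
    real_inner_self_eq_norm_sq, conj_trivial]
  change ‖x‖ ^ 2 * s ≤ _
  linarith

theorem add_smul_one_positiveResolvent (x : H) :
    T (positiveResolvent T s x) + s • positiveResolvent T s x = x := by
  have := Ring.mul_inverse_cancel _ (hT.isUnit_add_smul_one hs)
  simpa [positiveResolvent] using congr($this x)

theorem positiveResolvent_add_smul_one (x : H) :
    positiveResolvent T s (T x + s • x) = x := by
  have := Ring.inverse_mul_cancel _ (hT.isUnit_add_smul_one hs)
  simpa [positiveResolvent] using congr($this x)

theorem isSymmetric_positiveResolvent : (positiveResolvent T s : H →ₗ[ℝ] H).IsSymmetric := by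
  intro x y
  change ⟪positiveResolvent T s x, y⟫ = ⟪x, positiveResolvent T s y⟫
  conv_lhs => rw [← hT.add_smul_one_positiveResolvent hs y]
  conv_rhs => rw [← hT.add_smul_one_positiveResolvent hs x]
  rw [inner_add_left, inner_add_right, hT.inner_left_eq_inner_right, inner_smul_left,
    inner_smul_right]
  rfl

theorem norm_positiveResolvent_le : ‖positiveResolvent T s‖ ≤ s⁻¹ := by
  refine ContinuousLinearMap.opNorm_le_bound _ (inv_nonneg.2 hs.le) fun x => ?_
  set y := positiveResolvent T s x with hy
  have h1 : s * ‖y‖ ^ 2 ≤ ‖x‖ * ‖y‖ := by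
    refine le_trans ?_ (real_inner_le_norm x y)
    conv_rhs => rw [← hT.add_smul_one_positiveResolvent hs x]
    rw [← hy, inner_add_left, inner_smul_left, real_inner_self_eq_norm_sq]
    simpa using hT.inner_nonneg_left y
  rw [inv_mul_eq_div, le_div_iff₀ hs]
  rcases (norm_nonneg y).eq_or_lt with h | h
  · rw [← h]; simp
  · nlinarith

theorem positiveResolvent_apply_eigen {c : ℝ} (hc : 0 ≤ c) {v : H} (hv : T v = c • v) :
    positiveResolvent T s v = (c + s)⁻¹ • v := by
  have h := hT.positiveResolvent_add_smul_one hs v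
  rw [hv, ← add_smul, map_smul] at h
  rw [eq_inv_smul_iff₀ (by positivity), h]

theorem positiveResolvent_sub {B : H →L[ℝ] H} (hB : B.IsPositive) (x : H) :
    ⟪x, positiveResolvent B s x⟫ - ⟪x, positiveResolvent T s x⟫ =
      ⟪positiveResolvent T s x, (T - B) (positiveResolvent B s x)⟫ := by
  have h1 := hT.isSymmetric_positiveResolvent hs x ((T - B) (positiveResolvent B s x))
  change ⟪positiveResolvent T s x, _⟫ = ⟪x, positiveResolvent T s _⟫ at h1
  have h2 : (T - B) (positiveResolvent B s x) =
      (T (positiveResolvent B s x) + s • positiveResolvent B s x) -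
        (B (positiveResolvent B s x) + s • positiveResolvent B s x) := by
    rw [sub_apply]; abel
  rw [h1, h2, map_sub, hT.positiveResolvent_add_smul_one hs,
    hB.add_smul_one_positiveResolvent hs, inner_sub_right]

end ContinuousLinearMap.IsPositive

end Resolvent

section IntegralRepresentation

open Set MeasureTheory Real

theorem Real.lintegral_rpow_mul_inv_one_add_sq_le {r : ℝ} (hr : r ∈ Ioo (0 : ℝ) 1) :
    ∫⁻ t in Ioi (0 : ℝ), ENNReal.ofReal (t ^ r * ((1 + t)⁻¹) ^ 2) ≤
      ENNReal.ofReal (r * ∫ t in Ioi (0 : ℝ), rpowIntegrand₀₁ r t 1) := by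
  set K := ∫ t in Ioi (0 : ℝ), rpowIntegrand₀₁ r t 1
  have hbound : ∀ ε ∈ Ioo (0 : ℝ) 1,
      ∫⁻ t in Ioi (0 : ℝ), ENNReal.ofReal (t ^ r * ((1 + t)⁻¹) ^ 2) ≤
        ENNReal.ofReal (ε⁻¹ * ((1 + ε) ^ r - (1 - ε) ^ r) / 2 * K) := by
    rintro ε ⟨h0, h1⟩
    have hi1 := integrableOn_rpowIntegrand₀₁_Ioi hr (x := 1 + ε) (by linarith)
    have hi2 := integrableOn_rpowIntegrand₀₁_Ioi hr (x := 1 - ε) (by linarith)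
    have hle : ∀ t ∈ Ioi (0 : ℝ), t ^ r * ((1 + t)⁻¹) ^ 2 ≤
        (ε⁻¹ / 2) * (rpowIntegrand₀₁ r t (1 + ε) - rpowIntegrand₀₁ r t (1 - ε)) := by
      intro t ht
      have ht : 0 < t := ht
      have hp : 0 < t + (1 - ε) := by linarith
      have : (ε⁻¹ / 2) * (rpowIntegrand₀₁ r t (1 + ε) - rpowIntegrand₀₁ r t (1 - ε)) =
          t ^ r * ((t + (1 + ε)) * (t + (1 - ε)))⁻¹ := by
        unfold rpowIntegrand₀₁
        field_simp
        ring
      rw [this, inv_pow]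
      gcongr
      nlinarith
    have hint : IntegrableOn (fun t => (ε⁻¹ / 2) * (rpowIntegrand₀₁ r t (1 + ε) -
        rpowIntegrand₀₁ r t (1 - ε))) (Ioi 0) := (hi1.sub hi2).const_mul _
    calc _ ≤ ∫⁻ t in Ioi (0 : ℝ), ENNReal.ofReal ((ε⁻¹ / 2) * (rpowIntegrand₀₁ r t (1 + ε) -
            rpowIntegrand₀₁ r t (1 - ε))) :=
          setLIntegral_mono' measurableSet_Ioi fun t ht => ENNReal.ofReal_le_ofReal (hle t ht)
      _ = _ := by
        rw [← ofReal_integral_eq_lintegral_ofReal hint, integral_const_mul,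
          integral_sub hi1 hi2,
          integral_rpowIntegrand₀₁_eq_rpow_mul_const hr (x := 1 + ε) (by linarith),
          integral_rpowIntegrand₀₁_eq_rpow_mul_const hr (x := 1 - ε) (by linarith)]
        · congr 1; ring
        · refine (ae_restrict_iff' measurableSet_Ioi).2 (.of_forall fun t ht => ?_)
          have ht' : 0 < t := ht
          exact le_trans (by positivity) (hle t ht)
  have hderiv : HasDerivAt (fun ε : ℝ => (1 + ε) ^ r - (1 - ε) ^ r) (2 * r) 0 := by
    have h1 : HasDerivAt (fun ε : ℝ => (1 + ε) ^ r) (1 * r * (1 + 0) ^ (r - 1)) (0 : ℝ) :=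
      ((hasDerivAt_id (0 : ℝ)).const_add 1).rpow_const (by simp)
    have h2 : HasDerivAt (fun ε : ℝ => (1 - ε) ^ r) (-1 * r * (1 - 0) ^ (r - 1)) (0 : ℝ) :=
      ((hasDerivAt_id (0 : ℝ)).const_sub 1).rpow_const (by simp)
    convert! h1.sub h2 using 1
    simp
    ring
  have hlim := hderiv.tendsto_slope_zero_right
  simp only [zero_add, add_zero, sub_zero, sub_self, smul_eq_mul, one_rpow] at hlim
  have hlim2 := ENNReal.tendsto_ofReal ((hlim.div_const 2).mul_const K)
  rw [mul_div_cancel_left₀ _ two_ne_zero] at hlim2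
  refine ge_of_tendsto hlim2 ?_
  filter_upwards [Ioo_mem_nhdsGT (zero_lt_one' ℝ)] with ε hε using hbound ε hε

variable {H : Type*} [NormedAddCommGroup H] [InnerProductSpace ℝ H] [CompleteSpace H]
  {ι : Type*} [Countable ι]

theorem HilbertBasis.inner_one_add_rpow_eq_integral (e : HilbertBasis ι ℝ H) {T Tr : H →L[ℝ] H}
    (hT : T.IsPositive) {lam : ι → ℝ} (hlam : ∀ k, 0 ≤ lam k) (hTe : ∀ k, T (e k) = lam k • e k)
    {r : ℝ} (hr : r ∈ Ioo (0 : ℝ) 1) (hTr : ∀ k, Tr (e k) = ((1 + lam k) ^ r) • e k) (x : H) :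
    ∫ t in Ioi (0 : ℝ), t ^ r * (t⁻¹ * ‖x‖ ^ 2 - ⟪x, positiveResolvent T (1 + t) x⟫) =
      ⟪x, Tr x⟫ * ∫ t in Ioi (0 : ℝ), rpowIntegrand₀₁ r t 1 := by
  set K := ∫ t in Ioi (0 : ℝ), rpowIntegrand₀₁ r t 1
  have hpos : ∀ k, 0 ≤ 1 + lam k := fun k => by linarith [hlam k]
  set F : ι → ℝ → ℝ := fun k t => rpowIntegrand₀₁ r t (1 + lam k) * (⟪x, e k⟫ * ⟪e k, x⟫) with hF
  have hw : ∀ k, 0 ≤ ⟪x, e k⟫ * ⟪e k, x⟫ := fun k => by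
    rw [real_inner_comm]; exact mul_self_nonneg _
  have hFint : ∀ k, IntegrableOn (F k) (Ioi 0) := fun k =>
    (integrableOn_rpowIntegrand₀₁_Ioi hr (hpos k)).mul_const _
  have hFval : ∀ k, ∫ t in Ioi (0 : ℝ), F k t =
      (1 + lam k) ^ r * (⟪x, e k⟫ * ⟪e k, x⟫) * K := fun k => by
    rw [hF, integral_mul_const, integral_rpowIntegrand₀₁_eq_rpow_mul_const hr (hpos k)]
    ring
  have hFnorm : ∀ k, ∫ t in Ioi (0 : ℝ), ‖F k t‖ = ∫ t in Ioi (0 : ℝ), F k t := fun k =>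
    setIntegral_congr_fun measurableSet_Ioi fun t ht => norm_of_nonneg <|
      mul_nonneg (rpowIntegrand₀₁_nonneg hr.1 (le_of_lt ht) (hpos k)) (hw k)
  have hs := (e.hasSum_inner_apply_of_eigen hTr x x).mul_right K
  have h := hasSum_integral_of_summable_integral_norm hFint (by
    simp only [hFnorm, hFval]; exact hs.summable)
  simp only [hFval] at h
  rw [hs.unique h]
  refine setIntegral_congr_fun measurableSet_Ioi fun t ht => ?_
  have ht : 0 < t := ht
  have h1 := e.hasSum_inner_apply_of_eigen (T := positiveResolvent T (1 + t)) (fun k =>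
    hT.positiveResolvent_apply_eigen (by positivity) (hlam k) (hTe k)) x x
  have h2 := e.hasSum_inner_mul_inner x x
  rw [real_inner_self_eq_norm_sq] at h2
  refine Eq.symm (HasSum.tsum_eq ?_)
  convert! ((h2.mul_left t⁻¹).sub h1).mul_left (t ^ r) using 2 with k
  simp only [hF, rpowIntegrand₀₁]
  rw [show lam k + (1 + t) = t + (1 + lam k) by ring]
  ring

theorem HilbertBasis.integrableOn_rpow_mul_sub_inner_positiveResolvent (e : HilbertBasis ι ℝ H)
    {T Tr : H →L[ℝ] H} (hT : T.IsPositive) {lam : ι → ℝ} (hlam : ∀ k, 0 ≤ lam k)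
    (hTe : ∀ k, T (e k) = lam k • e k) {r : ℝ} (hr : r ∈ Ioo (0 : ℝ) 1)
    (hTr : ∀ k, Tr (e k) = ((1 + lam k) ^ r) • e k) {x : H} (hx : x ≠ 0) :
    IntegrableOn (fun t => t ^ r * (t⁻¹ * ‖x‖ ^ 2 - ⟪x, positiveResolvent T (1 + t) x⟫))
      (Ioi 0) := by
  refine Integrable.of_integral_ne_zero ?_
  rw [e.inner_one_add_rpow_eq_integral hT hlam hTe hr hTr]
  refine mul_ne_zero (ne_of_gt ?_) (integral_rpowIntegrand₀₁_one_pos hr).ne'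
  have h2 := e.hasSum_inner_mul_inner x x
  rw [real_inner_self_eq_norm_sq] at h2
  refine (sq_pos_of_pos (norm_pos_iff.2 hx)).trans_le
    (hasSum_le (fun k => ?_) h2 (e.hasSum_inner_apply_of_eigen hTr x x))
  refine le_mul_of_one_le_left ?_ (one_le_rpow (by linarith [hlam k]) hr.1.le)
  rw [real_inner_comm]; exact mul_self_nonneg _

end IntegralRepresentation

section TraceNorm

open Set MeasureTheory Real

variable {H : Type*} [NormedAddCommGroup H] [InnerProductSpace ℝ H] [CompleteSpace H]
  {ι κι α β : Type*} [Countable ι] [Countable κι]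

theorem HilbertBasis.tsum_ofReal_abs_eigen_one_add_rpow_sub_le
    (e : HilbertBasis ι ℝ H) (f : HilbertBasis κι ℝ H) {A B Ar Br : H →L[ℝ] H}
    (hA : A.IsPositive) (hB : B.IsPositive) {lam : ι → ℝ} {mu : κι → ℝ}
    (hlam : ∀ k, 0 ≤ lam k) (hmu : ∀ k, 0 ≤ mu k)
    (hAe : ∀ k, A (e k) = lam k • e k) (hBf : ∀ k, B (f k) = mu k • f k)
    {r : ℝ} (hr : r ∈ Ioo (0 : ℝ) 1)
    (hAr : ∀ k, Ar (e k) = ((1 + lam k) ^ r) • e k)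
    (hBr : ∀ k, Br (f k) = ((1 + mu k) ^ r) • f k)
    (h : HilbertBasis α ℝ H) {c : α → ℝ} (hc : ∀ k, (Ar - Br) (h k) = c k • h k)
    (d : HilbertBasis β ℝ H) {δ : β → ℝ} (hd : ∀ m, (A - B) (d m) = δ m • d m) :
    ∑' k, ENNReal.ofReal |c k| ≤ ENNReal.ofReal r * ∑' m, ENNReal.ofReal |δ m| := by
  set K := ∫ t in Ioi (0 : ℝ), rpowIntegrand₀₁ r t 1 with hK
  have hK0 : 0 < K := integral_rpowIntegrand₀₁_one_pos hr
  set G : α → ℝ → ℝ := fun k t =>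
    t ^ r * (t⁻¹ * ‖h k‖ ^ 2 - ⟪h k, positiveResolvent A (1 + t) (h k)⟫) -
      t ^ r * (t⁻¹ * ‖h k‖ ^ 2 - ⟪h k, positiveResolvent B (1 + t) (h k)⟫) with hG
  have hne : ∀ k, h k ≠ 0 := fun k => h.orthonormal.ne_zero k
  have hAi := fun k =>
    e.integrableOn_rpow_mul_sub_inner_positiveResolvent hA hlam hAe hr hAr (hne k)
  have hBi := fun k =>
    f.integrableOn_rpow_mul_sub_inner_positiveResolvent hB hmu hBf hr hBr (hne k)
  have hGi : ∀ k, IntegrableOn (G k) (Ioi 0) := fun k => (hAi k).sub (hBi k)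
  have hGval : ∀ k, ∫ t in Ioi (0 : ℝ), G k t = c k * K := fun k => by
    rw [hG, integral_sub (hAi k) (hBi k),
      e.inner_one_add_rpow_eq_integral hA hlam hAe hr hAr,
      f.inner_one_add_rpow_eq_integral hB hmu hBf hr hBr, ← sub_mul, ← inner_sub_right,
      ← sub_apply, hc, inner_smul_right, real_inner_self_eq_norm_sq,
      h.orthonormal.1 k]
    simp [hK]
  have hGt : ∀ t ∈ Ioi (0 : ℝ), ∀ k, ‖G k t‖ₑ = ENNReal.ofReal (t ^ r) * ENNReal.ofReal
      |⟪positiveResolvent A (1 + t) (h k), (A - B) (positiveResolvent B (1 + t) (h k))⟫| := by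
    intro t ht k
    have ht : 0 < t := ht
    rw [← hA.positiveResolvent_sub (by positivity) hB, Real.enorm_eq_ofReal_abs,
      ← ENNReal.ofReal_mul (by positivity), ← abs_of_nonneg (rpow_nonneg ht.le r), ← abs_mul, hG]
    congr 2
    ring
  set N := ∑' m, ENNReal.ofReal |δ m|
  have hfin : ∀ s : Finset α, ENNReal.ofReal K * ∑ k ∈ s, ENNReal.ofReal |c k| ≤
      ENNReal.ofReal K * (ENNReal.ofReal r * N) := fun s => by
    calc ENNReal.ofReal K * ∑ k ∈ s, ENNReal.ofReal |c k|
        = ∑ k ∈ s, ‖∫ t in Ioi (0 : ℝ), G k t‖ₑ := by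
          rw [Finset.mul_sum]
          refine Finset.sum_congr rfl fun k _ => ?_
          rw [hGval, Real.enorm_eq_ofReal_abs, abs_mul, abs_of_pos hK0,
            ENNReal.ofReal_mul (abs_nonneg _), mul_comm]
      _ ≤ ∑ k ∈ s, ∫⁻ t in Ioi (0 : ℝ), ‖G k t‖ₑ :=
          Finset.sum_le_sum fun k _ => enorm_integral_le_lintegral_enorm _
      _ = ∫⁻ t in Ioi (0 : ℝ), ∑ k ∈ s, ‖G k t‖ₑ :=
          (lintegral_finsetSum' _ fun k _ => (hGi k).1.enorm).symm
      _ ≤ ∫⁻ t in Ioi (0 : ℝ), ENNReal.ofReal (t ^ r * ((1 + t)⁻¹) ^ 2) * N := by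
          refine setLIntegral_mono' measurableSet_Ioi fun t ht => ?_
          have ht' : 0 < t := ht
          have ht1 : 0 < 1 + t := by linarith
          simp only [hGt t ht]
          rw [← Finset.mul_sum, ENNReal.ofReal_mul (by positivity), mul_assoc]
          gcongr
          exact (ENNReal.sum_le_tsum s).trans (h.tsum_ofReal_abs_inner_apply_le d hd
            (hA.isSymmetric_positiveResolvent ht1) (hB.isSymmetric_positiveResolvent ht1)
            (hA.norm_positiveResolvent_le ht1) (hB.norm_positiveResolvent_le ht1))
      _ = (∫⁻ t in Ioi (0 : ℝ), ENNReal.ofReal (t ^ r * ((1 + t)⁻¹) ^ 2)) * N :=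
          lintegral_mul_const _ (by fun_prop)
      _ ≤ ENNReal.ofReal (r * K) * N := by
          gcongr
          exact lintegral_rpow_mul_inv_one_add_sq_le hr
      _ = ENNReal.ofReal K * (ENNReal.ofReal r * N) := by
          rw [ENNReal.ofReal_mul hr.1.le]; ring
  rw [ENNReal.tsum_eq_iSup_sum]
  refine iSup_le fun s => ?_
  exact (ENNReal.mul_le_mul_iff_right (ENNReal.ofReal_pos.2 hK0).ne' ENNReal.ofReal_ne_top).1
    (hfin s)

end TraceNorm

section Summability

variable {H : Type*} [NormedAddCommGroup H] [InnerProductSpace ℝ H]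
  {ι κι α : Type*}

theorem HilbertBasis.tsum_ofReal_abs_eigen_sub_lt_top (e : HilbertBasis ι ℝ H)
    (f : HilbertBasis κι ℝ H) {A B : H →L[ℝ] H} {lam : ι → ℝ} {mu : κι → ℝ}
    (hlam : ∀ k, 0 ≤ lam k) (hmu : ∀ k, 0 ≤ mu k)
    (hAe : ∀ k, A (e k) = lam k • e k) (hBf : ∀ k, B (f k) = mu k • f k)
    (hA : A.IsPositive) (hB : B.IsPositive) (hAtr : Summable lam) (hBtr : Summable mu)
    (d : HilbertBasis α ℝ H) {δ : α → ℝ} (hd : ∀ m, (A - B) (d m) = δ m • d m) :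
    ∑' m, ENNReal.ofReal |δ m| < ⊤ := by
  have hle : ∀ m, ENNReal.ofReal |δ m| ≤
      ENNReal.ofReal ⟪d m, A (d m)⟫ + ENNReal.ofReal ⟪d m, B (d m)⟫ := fun m => by
    have h1 : ⟪d m, A (d m)⟫ - ⟪d m, B (d m)⟫ = δ m := by
      rw [← inner_sub_right, ← sub_apply, hd, inner_smul_right,
        real_inner_self_eq_norm_sq, d.orthonormal.1 m]
      simp
    have h2 := hA.inner_nonneg_right (d m)
    have h3 := hB.inner_nonneg_right (d m)
    rw [← ENNReal.ofReal_add h2 h3, ← h1]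
    refine ENNReal.ofReal_le_ofReal (abs_le.2 ⟨by linarith, by linarith⟩)
  refine (ENNReal.tsum_le_tsum hle).trans_lt ?_
  rw [ENNReal.tsum_add, d.tsum_ofReal_inner_apply_eq e hlam hAe,
    d.tsum_ofReal_inner_apply_eq f hmu hBf]
  exact ENNReal.add_lt_top.2 ⟨hAtr.tsum_ofReal_lt_top, hBtr.tsum_ofReal_lt_top⟩

theorem HilbertBasis.isCompactOperator_one_add_rpow_sub_one [CompleteSpace H]
    (e : HilbertBasis ι ℝ H) {Ar : H →L[ℝ] H} {lam : ι → ℝ} (hlam : ∀ k, 0 ≤ lam k)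
    (hAtr : Summable lam) {r : ℝ} (hr0 : 0 ≤ r) (hr1 : r ≤ 1)
    (hAr : ∀ k, Ar (e k) = ((1 + lam k) ^ r) • e k) :
    IsCompactOperator (Ar - 1 : H →L[ℝ] H) := by
  refine e.isCompactOperator_of_eigen_of_summable (lam := fun k => (1 + lam k) ^ r - 1)
    (fun k => by simp [hAr, sub_smul]) ?_
  refine hAtr.of_nonneg_of_le (fun _ => abs_nonneg _) fun k => ?_
  have h1 := Real.one_le_rpow (x := 1 + lam k) (by linarith [hlam k]) hr0
  have h2 := Real.rpow_le_rpow_of_exponent_le (x := 1 + lam k) (by linarith [hlam k]) hr1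
  rw [Real.rpow_one] at h2
  rw [abs_of_nonneg (by linarith)]
  linarith

end Summability

theorem trace_norm_one_add_rpow_sub_le
    {H : Type*} [NormedAddCommGroup H] [InnerProductSpace ℝ H] [CompleteSpace H]
    {ι κι γ : Type*} [Countable ι] [Countable κι] [Countable γ]
    (e : HilbertBasis ι ℝ H) (f : HilbertBasis κι ℝ H) (g : HilbertBasis γ ℝ H)
    (A B : H →L[ℝ] H) (hA : A.IsPositive) (hB : B.IsPositive)
    (lam : ι → ℝ) (mu : κι → ℝ)
    (hlam : ∀ k, 0 ≤ lam k) (hmu : ∀ k, 0 ≤ mu k)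
    (hAe : ∀ k, A (e k) = lam k • (e k : H))
    (hBf : ∀ k, B (f k) = mu k • (f k : H))
    (hAtr : Summable lam) (hBtr : Summable mu)
    (r : ℝ) (hr0 : 0 ≤ r) (hr1 : r ≤ 1)
    (Ar Br : H →L[ℝ] H)
    (hAr : ∀ k, Ar (e k) = ((1 + lam k) ^ r) • (e k : H))
    (hBr : ∀ k, Br (f k) = ((1 + mu k) ^ r) • (f k : H))
    (S S' : H →L[ℝ] H)
    (hS : S.IsPositive ∧ S ∘L S = (Ar - Br).adjoint ∘L (Ar - Br))
    (hS' : S'.IsPositive ∧ S' ∘L S' = (A - B).adjoint ∘L (A - B)) :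
    (Summable fun k => ⟪(g k : H), S (g k)⟫) ∧
    (∑' k, ⟪(g k : H), S (g k)⟫) ≤ r * ∑' k, ⟪(g k : H), S' (g k)⟫ := by
  set C := Ar - Br with hC
  set D := A - B with hD
  have hCsymm : (C : H →ₗ[ℝ] H).IsSymmetric :=
    (e.isSymmetric_of_eigen hAr).sub (f.isSymmetric_of_eigen hBr)
  have hDsymm : (D : H →ₗ[ℝ] H).IsSymmetric := hA.isSymmetric.sub hB.isSymmetric
  have hCcpt : IsCompactOperator C := by
    have := (e.isCompactOperator_one_add_rpow_sub_one hlam hAtr hr0 hr1 hAr).sub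
      (f.isCompactOperator_one_add_rpow_sub_one hmu hBtr hr0 hr1 hBr)
    convert! this using 1
    ext x
    simp [hC]
  have hDcpt : IsCompactOperator D :=
    (e.isCompactOperator_of_eigen_of_summable hAe hAtr.abs).sub
      (f.isCompactOperator_of_eigen_of_summable hBf hBtr.abs)
  obtain ⟨_, h, c, hc⟩ := hCcpt.exists_hilbertBasis_eigen hCsymm
  obtain ⟨_, d, δ, hd⟩ := hDcpt.exists_hilbertBasis_eigen hDsymm
  have hN := e.tsum_ofReal_abs_eigen_sub_lt_top f hlam hmu hAe hBf hA hB hAtr hBtr d hd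
  have hcS := g.tsum_ofReal_inner_apply_eq h (fun k => abs_nonneg (c k))
    fun k => hS.1.apply_eigen_of_sq hCsymm hS.2 (hc k)
  have hdS := g.tsum_ofReal_inner_apply_eq d (fun k => abs_nonneg (δ k))
    fun k => hS'.1.apply_eigen_of_sq hDsymm hS'.2 (hd k)
  have hcinner : ∀ k, c k = ⟪h k, Ar (h k) - Br (h k)⟫ := fun k => by
    rw [← sub_apply, ← hC, hc, inner_smul_right, real_inner_self_eq_norm_sq,
      h.orthonormal.1 k]
    simp
  have key : ∑' k, ENNReal.ofReal |c k| ≤ ENNReal.ofReal r * ∑' m, ENNReal.ofReal |δ m| := by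
    rcases hr0.eq_or_lt with rfl | hr0
    · have h0 : ∀ k, c k = 0 := fun k => by
        have h1 := e.hasSum_inner_apply_of_eigen hAr (h k) (h k)
        have h2 := f.hasSum_inner_apply_of_eigen hBr (h k) (h k)
        simp only [Real.rpow_zero, one_mul] at h1 h2
        rw [hcinner, inner_sub_right, h1.unique (e.hasSum_inner_mul_inner _ _),
          h2.unique (f.hasSum_inner_mul_inner _ _), sub_self]
      simp [h0]
    rcases hr1.eq_or_lt with rfl | hr1
    · have h1 : ∀ k, c k = ⟪(1 : H →L[ℝ] H) (h k), D ((1 : H →L[ℝ] H) (h k))⟫ := fun k => by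
        have h1 := e.hasSum_inner_apply_of_eigen hAr (h k) (h k)
        have h2 := f.hasSum_inner_apply_of_eigen hBr (h k) (h k)
        simp only [Real.rpow_one, add_mul, one_mul] at h1 h2
        rw [hcinner, inner_sub_right,
          h1.unique ((e.hasSum_inner_mul_inner _ _).add (e.hasSum_inner_apply_of_eigen hAe _ _)),
          h2.unique ((f.hasSum_inner_mul_inner _ _).add (f.hasSum_inner_apply_of_eigen hBf _ _))]
        simp [hD, inner_sub_right]
      simp only [h1]
      have hone : ‖(1 : H →L[ℝ] H)‖ ≤ 1 := ContinuousLinearMap.norm_id_le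
      simpa using h.tsum_ofReal_abs_inner_apply_le d hd LinearMap.IsSymmetric.id
        LinearMap.IsSymmetric.id hone hone
    exact e.tsum_ofReal_abs_eigen_one_add_rpow_sub_le f hA hB hlam hmu hAe hBf ⟨hr0, hr1⟩ hAr hBr
      h hc d hd
  rw [← hcS, ← hdS] at key
  rw [← hdS] at hN
  have hSnn : ∀ k, 0 ≤ ⟪g k, S (g k)⟫ := fun k => hS.1.inner_nonneg_right _
  have hSnn' : ∀ k, 0 ≤ ⟪g k, S' (g k)⟫ := fun k => hS'.1.inner_nonneg_right _
  have hrN := ENNReal.mul_lt_top (ENNReal.ofReal_lt_top (r := r)) hN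
  have hsum : Summable fun k => ⟪g k, S (g k)⟫ := by
    simpa only [ENNReal.toReal_ofReal (hSnn _)] using
      ENNReal.summable_toReal (key.trans_lt hrN).ne
  have hsum' : Summable fun k => ⟪g k, S' (g k)⟫ := by
    simpa only [ENNReal.toReal_ofReal (hSnn' _)] using ENNReal.summable_toReal hN.ne
  refine ⟨hsum, ?_⟩
  rw [← ENNReal.ofReal_tsum_of_nonneg hSnn hsum, ← ENNReal.ofReal_tsum_of_nonneg hSnn' hsum',
    ← ENNReal.ofReal_mul hr0] at key
  exact (ENNReal.ofReal_le_ofReal_iff (mul_nonneg hr0 (tsum_nonneg hSnn'))).1 key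

end
end
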